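/- In the transportation network setting (B ∈ ℝ^{N×n} with B^T ℂ B positive definite, ℂ = diag(ℂ_e) with ℂ_e > 0, s_e > 0, Φ_D(ε,σ) = Σ_e (ℂ_e^{−1}/(2 s_e²))|σ_e − ℂ_e ε_e|², norm ‖(ε,σ)‖² = Σ_e (ℂ_e|ε_e|² + ℂ_e^{−1}|σ_e|²), E = {(ε,σ) : ε = Bu + g, B^T σ = f} nonempty), there exist constants β₀ > 0, c > 0, b > 0 such that c(‖y‖² + ‖z‖²) ≤ β₀ ‖y − z‖² + Φ_D(y) + b for all y ∈ Z and all z ∈ E; that is, Φ_D satisfies the sub-Gaussian transversality condition with respect to E. -/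

import Mathlib

open Matrix

noncomputable section

/-- Squared weighted norm on phase space `Z = ℝ^N × ℝ^N`:
`‖(ε,σ)‖² = Σ_e (ℂ_e |ε_e|² + ℂ_e⁻¹ |σ_e|²)`. -/
def nsq {N : ℕ} (Cc : Fin N → ℝ) (z : (Fin N → ℝ) × (Fin N → ℝ)) : ℝ :=
  ∑ e, (Cc e * (z.1 e) ^ 2 + (Cc e)⁻¹ * (z.2 e) ^ 2)

/-- Material logarithmic potential
`Φ_D(ε,σ) = Σ_e (ℂ_e⁻¹/(2 s_e²)) |σ_e − ℂ_e ε_e|²`. -/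
def PhiD {N : ℕ} (Cc s : Fin N → ℝ) (z : (Fin N → ℝ) × (Fin N → ℝ)) : ℝ :=
  ∑ e, (Cc e)⁻¹ / (2 * (s e) ^ 2) * (z.2 e - Cc e * z.1 e) ^ 2

/-- Unweighted distance to the material set `σ = ℂε`: `Σ_e ℂ_e⁻¹ |σ_e − ℂ_e ε_e|²`. -/
def materialGap {N : ℕ} (Cc : Fin N → ℝ) (z : (Fin N → ℝ) × (Fin N → ℝ)) : ℝ :=
  ∑ e, (Cc e)⁻¹ * (z.2 e - Cc e * z.1 e) ^ 2

section

variable {N : ℕ} {Cc : Fin N → ℝ}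

lemma nsq_nonneg (hCc : ∀ e, 0 < Cc e) (z : (Fin N → ℝ) × (Fin N → ℝ)) : 0 ≤ nsq Cc z :=
  Finset.sum_nonneg fun e _ => by have := hCc e; positivity

lemma nsq_le_two_mul_sub_add (hCc : ∀ e, 0 < Cc e) (z w : (Fin N → ℝ) × (Fin N → ℝ)) :
    nsq Cc z ≤ 2 * nsq Cc (z - w) + 2 * nsq Cc w := by
  simp only [nsq, Finset.mul_sum, ← Finset.sum_add_distrib]
  refine Finset.sum_le_sum fun e _ => ?_
  have h₁ := mul_nonneg (hCc e).le (sq_nonneg (z.1 e - 2 * w.1 e))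
  have h₂ := mul_nonneg (inv_pos.2 (hCc e)).le (sq_nonneg (z.2 e - 2 * w.2 e))
  simp only [Prod.fst_sub, Prod.snd_sub, Pi.sub_apply]
  linarith

/-- When strain and stress are orthogonal, the material gap is the full squared norm. -/
lemma materialGap_eq_nsq_of_dotProduct_eq_zero (hCc : ∀ e, 0 < Cc e)
    {z : (Fin N → ℝ) × (Fin N → ℝ)} (hz : z.1 ⬝ᵥ z.2 = 0) :
    materialGap Cc z = nsq Cc z := by
  have h : materialGap Cc z = nsq Cc z - 2 * (z.1 ⬝ᵥ z.2) := by
    simp only [materialGap, nsq, dotProduct, Finset.mul_sum, ← Finset.sum_sub_distrib]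
    refine Finset.sum_congr rfl fun e _ => ?_
    have := (hCc e).ne'
    field_simp
    ring
  rw [h, hz, mul_zero, sub_zero]

lemma materialGap_le_two_mul_nsq (hCc : ∀ e, 0 < Cc e) (z : (Fin N → ℝ) × (Fin N → ℝ)) :
    materialGap Cc z ≤ 2 * nsq Cc z := by
  simp only [materialGap, nsq, Finset.mul_sum]
  refine Finset.sum_le_sum fun e _ => ?_
  have h := mul_nonneg (inv_pos.2 (hCc e)).le (sq_nonneg (z.2 e + Cc e * z.1 e))
  have hC : Cc e * z.1 e ^ 2 = (Cc e)⁻¹ * (Cc e * z.1 e) ^ 2 := by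
    have := (hCc e).ne'
    field_simp
  rw [hC]
  linarith

lemma materialGap_sub_le (hCc : ∀ e, 0 < Cc e) (y z w : (Fin N → ℝ) × (Fin N → ℝ)) :
    materialGap Cc (z - w) ≤
      3 * (materialGap Cc (y - z) + materialGap Cc y + materialGap Cc w) := by
  simp only [materialGap, Finset.mul_sum, ← Finset.sum_add_distrib]
  refine Finset.sum_le_sum fun e _ => ?_
  simp only [Prod.fst_sub, Prod.snd_sub, Pi.sub_apply]
  have key : ∀ a b c : ℝ, (b - c) ^ 2 ≤ 3 * ((a - b) ^ 2 + a ^ 2 + c ^ 2) := fun a b c => by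
    nlinarith [sq_nonneg (a - b + a), sq_nonneg (a - b - c), sq_nonneg (a + c)]
  have h := mul_le_mul_of_nonneg_left
    (key (y.2 e - Cc e * y.1 e) (z.2 e - Cc e * z.1 e) (w.2 e - Cc e * w.1 e))
    (inv_pos.2 (hCc e)).le
  linarith

lemma exists_pos_mul_materialGap_le_PhiD (hCc : ∀ e, 0 < Cc e) {s : Fin N → ℝ}
    (hs : ∀ e, 0 < s e) :
    ∃ m : ℝ, 0 < m ∧ ∀ y, m * materialGap Cc y ≤ PhiD Cc s y := by
  have hsum : 0 ≤ ∑ e, 2 * s e ^ 2 := Finset.sum_nonneg fun e _ => by positivity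
  refine ⟨(1 + ∑ e, 2 * s e ^ 2)⁻¹, by positivity, fun y => ?_⟩
  simp only [materialGap, PhiD, Finset.mul_sum]
  refine Finset.sum_le_sum fun e _ => ?_
  have hse : 2 * s e ^ 2 ≤ 1 + ∑ e, 2 * s e ^ 2 := by
    have := Finset.single_le_sum (f := fun e => 2 * s e ^ 2)
      (fun i _ => by positivity) (Finset.mem_univ e)
    linarith
  have hpos : 0 < 2 * s e ^ 2 := by have := hs e; positivity
  have hq : 0 ≤ (Cc e)⁻¹ * (y.2 e - Cc e * y.1 e) ^ 2 := by have := hCc e; positivity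
  have h := mul_le_mul_of_nonneg_right (inv_anti₀ hpos hse) hq
  simp only [← Finset.mul_sum] at h ⊢
  calc _ ≤ _ := h
    _ = _ := by rw [div_eq_mul_inv]; ring

end

/-!
STATEMENT 18: `Φ_D` satisfies the sub-Gaussian transversality condition with respect
to the (nonempty) admissible set `E = {(ε,σ) : ε = Bu + g, Bᵀσ = f}`: there are
`β₀, c, b > 0` with `c(‖y‖² + ‖z‖²) ≤ β₀‖y − z‖² + Φ_D(y) + b` for all `y ∈ Z`, `z ∈ E`.
-/

theorem PhiD_subGaussian_transversality
    (N n : ℕ) (B : Matrix (Fin N) (Fin n) ℝ)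
    (Cc : Fin N → ℝ) (hCc : ∀ e, 0 < Cc e)
    (s : Fin N → ℝ) (hs : ∀ e, 0 < s e)
    (hposdef : (B.transpose * Matrix.diagonal Cc * B).PosDef)
    (f : Fin n → ℝ) (g : Fin N → ℝ)
    (hEne : ∃ z : (Fin N → ℝ) × (Fin N → ℝ),
      (∃ u : Fin n → ℝ, z.1 = B.mulVec u + g) ∧ B.transpose.mulVec z.2 = f) :
    ∃ β₀ : ℝ, 0 < β₀ ∧ ∃ c : ℝ, 0 < c ∧ ∃ b : ℝ, 0 < b ∧
      ∀ y z : (Fin N → ℝ) × (Fin N → ℝ),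
        (∃ u : Fin n → ℝ, z.1 = B.mulVec u + g) → B.transpose.mulVec z.2 = f →
        c * (nsq Cc y + nsq Cc z) ≤ β₀ * nsq Cc (y - z) + PhiD Cc s y + b := by
  obtain ⟨w, ⟨v, hv⟩, hwf⟩ := hEne
  obtain ⟨m, hm, hΦ⟩ := exists_pos_mul_materialGap_le_PhiD hCc hs
  have hw := nsq_nonneg hCc w
  refine ⟨38 * (m / 18), by positivity, m / 18, by positivity,
    42 * (m / 18) * nsq Cc w + 1, by positivity, fun y z ⟨u, hu⟩ hzf => ?_⟩
  have horth : (z - w).1 ⬝ᵥ (z - w).2 = 0 := by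
    have h₁ : (z - w).1 = B *ᵥ (u - v) := by
      rw [Prod.fst_sub, hu, hv, mulVec_sub, add_sub_add_right_eq_sub]
    have h₂ : Bᵀ *ᵥ (z - w).2 = 0 := by
      rw [Prod.snd_sub, mulVec_sub, hzf, hwf, sub_self]
    rw [h₁, dotProduct_comm, dotProduct_mulVec, ← mulVec_transpose, h₂, zero_dotProduct]
  have hgap := materialGap_eq_nsq_of_dotProduct_eq_zero hCc horth
  have hbound : nsq Cc y + nsq Cc z ≤
      38 * nsq Cc (y - z) + 18 * materialGap Cc y + 42 * nsq Cc w := by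
    linarith [nsq_le_two_mul_sub_add hCc y z, nsq_le_two_mul_sub_add hCc z w,
      materialGap_sub_le hCc y z w, materialGap_le_two_mul_nsq hCc (y - z),
      materialGap_le_two_mul_nsq hCc w]
  have hmul := mul_le_mul_of_nonneg_left hbound (div_pos hm (by norm_num : (0 : ℝ) < 18)).le
  linarith [hΦ y]
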